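/- In an $\mathcal{N}_n$-space $X$, a closed subset that is a countable union of $Z$-sets in $X$ is itself a $Z$-set in $X$. -/

import Mathlib

open Set ContinuousMap
open scoped ENNReal

namespace NobelingPaper

/-- Covering dimension at most `n`: every open cover admits an open refinement in
which every point lies in at most `n + 1` elements. -/
def CovDimLE (X : Type) [TopologicalSpace X] (n : ℕ) : Prop :=
  ∀ (ι : Type) (U : ι → Set X), (∀ i, IsOpen (U i)) → (⋃ i, U i) = univ →
    ∃ (κ : Type) (W : κ → Set X), (∀ j, IsOpen (W j)) ∧ (⋃ j, W j) = univ ∧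
      (∀ j, ∃ i, W j ⊆ U i) ∧
      ∀ s : Finset κ, (∃ x, ∀ j ∈ s, x ∈ W j) → s.card ≤ n + 1

/-- Covering dimension exactly `n`. -/
def CovDimEq (X : Type) [TopologicalSpace X] (n : ℕ) : Prop :=
  CovDimLE X n ∧ ∀ m, CovDimLE X m → n ≤ m

/-- `Y` is an absolute neighborhood extensor in dimension `n`: every map into `Y`
from a closed subset of an at most `n`-dimensional metric space extends over an open
neighborhood of that subset. -/
def IsANE (n : ℕ) (Y : Type) [MetricSpace Y] : Prop :=
  ∀ (X : Type) [MetricSpace X], CovDimLE X n → ∀ (A : Set X), IsClosed A →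
    ∀ f : C(A, Y), ∃ U : Set X, ∃ (_ : IsOpen U) (hAU : A ⊆ U),
      ∃ g : C(U, Y), ∀ a : A, g (Set.inclusion hAU a) = f a

/-- `g` is `U`-close to `f`. -/
def UClose {Z X ι : Type} (U : ι → Set X) (f g : Z → X) : Prop :=
  ∀ z, ∃ i, f z ∈ U i ∧ g z ∈ U i

/-- A `Z`-set: a closed subset `A` such that the identity is approximable, with
respect to every open cover, by maps into the complement of `A`. -/
def IsZSet (X : Type) [TopologicalSpace X] (A : Set X) : Prop :=
  IsClosed A ∧ ∀ (ι : Type) (U : ι → Set X), (∀ i, IsOpen (U i)) → (⋃ i, U i) = univ →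
    ∃ f : C(X, X), UClose U id f ∧ ∀ x, f x ∉ A

/-- `X` is strongly universal in dimension `n`: every map from an at most
`n`-dimensional Polish space into `X` is approximable by closed embeddings. -/
def StronglyUniversal (n : ℕ) (X : Type) [MetricSpace X] : Prop :=
  ∀ (P : Type) [MetricSpace P], PolishSpace P → CovDimLE P n →
    ∀ f : C(P, X), ∀ (ι : Type) (U : ι → Set X), (∀ i, IsOpen (U i)) → (⋃ i, U i) = univ →
      ∃ g : C(P, X), UClose U f g ∧ Topology.IsClosedEmbedding g

/-- An `N_n`-space: an `n`-dimensional Polish `ANE(n)`-space that is strongly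
universal in dimension `n`. -/
def IsNnSpace (n : ℕ) (X : Type) [MetricSpace X] : Prop :=
  PolishSpace X ∧ CovDimEq X n ∧ IsANE n X ∧ StronglyUniversal n X

/-- A subset `S` of `Y` has covering dimension at most `n`, expressed through families of
open subsets of `Y`: every family covering `S` shrinks to a family covering `S` in which each
point of `S` lies in at most `n + 1` members. -/
def SubDimLE {Y : Type} [TopologicalSpace Y] (S : Set Y) (n : ℕ) : Prop :=
  ∀ (ι : Type) (U : ι → Set Y), (∀ i, IsOpen (U i)) → S ⊆ ⋃ i, U i →
    ∃ V : ι → Set Y, (∀ i, IsOpen (V i)) ∧ (∀ i, V i ⊆ U i) ∧ S ⊆ ⋃ i, V i ∧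
      ∀ s : Finset ι, (∃ x ∈ S, ∀ i ∈ s, x ∈ V i) → s.card ≤ n + 1

/-- In the definition of covering dimension the refinement may be indexed by the original
cover. -/
theorem CovDimLE.exists_shrink {Z : Type} [TopologicalSpace Z] {n : ℕ} (h : CovDimLE Z n)
    {ι : Type} (U : ι → Set Z) (hU : ∀ i, IsOpen (U i)) (hc : ⋃ i, U i = univ) :
    ∃ V : ι → Set Z, (∀ i, IsOpen (V i)) ∧ (∀ i, V i ⊆ U i) ∧ ⋃ i, V i = univ ∧
      ∀ s : Finset ι, (∃ x, ∀ i ∈ s, x ∈ V i) → s.card ≤ n + 1 := by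
  classical
  obtain ⟨κ, W, hWo, hWc, hWU, hcard⟩ := h ι U hU hc
  choose φ hφ using hWU
  refine ⟨fun i => ⋃ j : {j // φ j = i}, W j, fun i => isOpen_iUnion fun j => hWo _, ?_, ?_, ?_⟩
  · rintro i x hx
    obtain ⟨⟨j, rfl⟩, hj⟩ := mem_iUnion.1 hx
    exact hφ _ hj
  · refine eq_univ_of_forall fun x => ?_
    obtain ⟨j, hj⟩ := mem_iUnion.1 (hWc ▸ mem_univ x)
    exact mem_iUnion.2 ⟨φ j, mem_iUnion.2 ⟨⟨j, rfl⟩, hj⟩⟩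
  · rintro s ⟨x, hx⟩
    have : ∀ i : s, ∃ j, φ j = i ∧ x ∈ W j := fun i => by
      obtain ⟨⟨j, hj⟩, hxj⟩ := mem_iUnion.1 (hx i i.2)
      exact ⟨j, hj, hxj⟩
    choose g hg hxg using this
    have hinj : Function.Injective g := fun a b hab => Subtype.ext (by rw [← hg a, ← hg b, hab])
    have := hcard (Finset.univ.map ⟨g, hinj⟩) ⟨x, fun j hj => by
      obtain ⟨i, -, rfl⟩ := Finset.mem_map.1 hj
      exact hxg i⟩
    simpa using this

theorem subDimLE_range {Y Z : Type} [TopologicalSpace Y] [TopologicalSpace Z] {e : Z → Y}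
    (he : Topology.IsInducing e) {n : ℕ} (h : CovDimLE Z n) : SubDimLE (range e) n := by
  intro ι U hU hc
  obtain ⟨V, hVo, hVU, hVc, hcard⟩ := h.exists_shrink (fun i => e ⁻¹' U i)
    (fun i => (hU i).preimage he.continuous) (by
      refine eq_univ_of_forall fun z => ?_
      obtain ⟨i, hi⟩ := mem_iUnion.1 (hc (mem_range_self z))
      exact mem_iUnion.2 ⟨i, hi⟩)
  choose V' hV'o hV' using fun i => he.isOpen_iff.1 (hVo i)
  refine ⟨fun i => V' i ∩ U i, fun i => (hV'o i).inter (hU i), fun i => inter_subset_right, ?_, ?_⟩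
  · rintro _ ⟨z, rfl⟩
    obtain ⟨i, hi⟩ := mem_iUnion.1 (hVc ▸ mem_univ z)
    refine mem_iUnion.2 ⟨i, ?_, hVU i hi⟩
    rw [← hV' i] at hi
    exact hi
  · rintro s ⟨_, ⟨z, rfl⟩, hz⟩
    refine hcard s ⟨z, fun i hi => ?_⟩
    rw [← hV' i]
    exact (hz i hi).1

theorem SubDimLE.covDimLE {Y Z : Type} [TopologicalSpace Y] [TopologicalSpace Z] {e : Z → Y}
    (he : Topology.IsInducing e) {n : ℕ} (h : SubDimLE (range e) n) : CovDimLE Z n := by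
  intro ι U hU hc
  choose U' hU'o hU' using fun i => he.isOpen_iff.1 (hU i)
  obtain ⟨V, hVo, hVU, hVc, hcard⟩ := h ι U' hU'o (by
    rintro _ ⟨z, rfl⟩
    obtain ⟨i, hi⟩ := mem_iUnion.1 (hc ▸ mem_univ z)
    rw [← hU' i] at hi
    exact mem_iUnion.2 ⟨i, hi⟩)
  refine ⟨ι, fun i => e ⁻¹' V i, fun i => (hVo i).preimage he.continuous, ?_, fun i => ⟨i, ?_⟩, ?_⟩
  · refine eq_univ_of_forall fun z => ?_
    obtain ⟨i, hi⟩ := mem_iUnion.1 (hVc (mem_range_self z))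
    exact mem_iUnion.2 ⟨i, hi⟩
  · rw [← hU' i]
    exact preimage_mono (hVU i)
  · rintro s ⟨z, hz⟩
    exact hcard s ⟨e z, mem_range_self z, hz⟩

theorem CovDimLE.subDimLE_of_isClosed {Y : Type} [TopologicalSpace Y] {n : ℕ}
    (h : CovDimLE Y n) {S : Set Y} (hS : IsClosed S) : SubDimLE S n := by
  intro ι U hU hc
  obtain ⟨V, hVo, hVU, hVc, hcard⟩ := h.exists_shrink (fun o : Option ι => o.elim Sᶜ U)
    (by rintro (_ | i); exacts [hS.isOpen_compl, hU i]) (by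
      refine eq_univ_of_forall fun x => ?_
      by_cases hx : x ∈ S
      · obtain ⟨i, hi⟩ := mem_iUnion.1 (hc hx)
        exact mem_iUnion.2 ⟨some i, hi⟩
      · exact mem_iUnion.2 ⟨none, hx⟩)
  refine ⟨fun i => V (some i), fun i => hVo _, fun i => hVU (some i), fun x hx => ?_, ?_⟩
  · obtain ⟨_ | i, hi⟩ := mem_iUnion.1 (hVc ▸ mem_univ x)
    · exact absurd hx (hVU none hi)
    · exact mem_iUnion.2 ⟨i, hi⟩
  · rintro s ⟨x, -, hx⟩
    have := hcard (s.map Function.Embedding.some) ⟨x, fun o ho => by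
      obtain ⟨i, hi, rfl⟩ := Finset.mem_map.1 ho
      exact hx i hi⟩
    simpa using this

/-- A set that is the disjoint union of relatively open pieces of dimension at most `n` has
dimension at most `n`. -/
theorem subDimLE_of_fibers {Y T : Type} [TopologicalSpace Y] {n : ℕ} {S : Set Y} (tag : Y → T)
    (O : T → Set Y) (hO : ∀ t, IsOpen (O t)) (hOS : ∀ t, ∀ y ∈ S, y ∈ O t ↔ tag y = t)
    (h : ∀ t, SubDimLE {y ∈ S | tag y = t} n) : SubDimLE S n := by
  intro ι U hU hc
  choose V hVo hVU hVc hcard using fun t => h t ι U hU ((sep_subset _ _).trans hc)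
  refine ⟨fun i => ⋃ t, V t i ∩ O t, fun i => isOpen_iUnion fun t => (hVo t i).inter (hO t),
    fun i => iUnion_subset fun t => inter_subset_left.trans (hVU t i), fun y hy => ?_, ?_⟩
  · obtain ⟨i, hi⟩ := mem_iUnion.1 (hVc (tag y) ⟨hy, rfl⟩)
    exact mem_iUnion.2 ⟨i, mem_iUnion.2 ⟨tag y, hi, (hOS _ y hy).2 rfl⟩⟩
  · rintro s ⟨y, hy, hys⟩
    refine hcard (tag y) s ⟨y, ⟨hy, rfl⟩, fun i hi => ?_⟩
    obtain ⟨t, ht, htO⟩ := mem_iUnion.1 (hys i hi)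
    rwa [(hOS t y hy).1 htO]

/-- If `y` is closer to `S` than to each of the sets `S \ V i`, then some point of `S` lies in
all the `V i`. -/
theorem exists_mem_forall_of_infEDist_lt {Y ι : Type} [MetricSpace Y] {S : Set Y} {V : ι → Set Y}
    (s : Finset ι) (hs : s.Nonempty) {y : Y}
    (h : ∀ i ∈ s, Metric.infEDist y S < Metric.infEDist y (S \ V i)) :
    ∃ x ∈ S, ∀ i ∈ s, x ∈ V i := by
  obtain ⟨j, hj, hmin⟩ := s.exists_min_image (fun i => Metric.infEDist y (S \ V i)) hs
  obtain ⟨x, hxS, hx⟩ := Metric.infEDist_lt_iff.1 (h j hj)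
  refine ⟨x, hxS, fun i hi => ?_⟩
  by_contra hxi
  have : Metric.infEDist y (S \ V i) ≤ edist y x := Metric.infEDist_le_edist_of_mem ⟨hxS, hxi⟩
  exact absurd hx (not_lt.2 ((hmin i hi).trans this))

/-- A sum theorem: if `S` is closed, and both `S` and `S'` have dimension at most `n`, then so
does their union. -/
theorem covDimLE_of_union {Y : Type} [MetricSpace Y] {n : ℕ} {S S' : Set Y} (hS : IsClosed S)
    (hun : S ∪ S' = univ) (h : SubDimLE S n) (h' : SubDimLE S' n) : CovDimLE Y n := by
  classical
  intro ι O hO hc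
  obtain ⟨V, hVo, hVO, hVc, hcard⟩ := h ι O hO (by rw [hc]; exact subset_univ _)
  set V' : ι → Set Y := fun i =>
    V i ∩ {y | Metric.infEDist y S < Metric.infEDist y (S \ V i)} with hV'
  have hV'o : ∀ i, IsOpen (V' i) := fun i =>
    (hVo i).inter (isOpen_lt Metric.continuous_infEDist Metric.continuous_infEDist)
  have hSV' : S ⊆ ⋃ i, V' i := by
    intro y hy
    obtain ⟨i, hi⟩ := mem_iUnion.1 (hVc hy)
    refine mem_iUnion.2 ⟨i, hi, ?_⟩
    rw [mem_ofPred_eq, Metric.infEDist_zero_of_mem hy, Metric.infEDist_pos_iff_notMem_closure]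
    intro hcl
    obtain ⟨z, hz, hz'⟩ := mem_closure_iff.1 hcl (V i) (hVo i) hi
    exact hz'.2 hz
  have hcard' : ∀ s : Finset ι, (∃ y, ∀ i ∈ s, y ∈ V' i) → s.card ≤ n + 1 := by
    rintro s ⟨y, hy⟩
    rcases s.eq_empty_or_nonempty with rfl | hs
    · simp
    · exact hcard s (exists_mem_forall_of_infEDist_lt s hs fun i hi => (hy i hi).2)
  obtain ⟨G, hGo, hSG, hGN⟩ := normal_exists_closure_subset hS (isOpen_iUnion hV'o) hSV'
  obtain ⟨R, hRo, hRO, hRc, hcardR⟩ := h' (ι ⊕ ι) (Sum.elim V' fun i => O i \ closure G)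
    (by rintro (i | i); exacts [hV'o i, (hO i).sdiff isClosed_closure]) (by
      intro y _
      by_cases hy : y ∈ closure G
      · obtain ⟨i, hi⟩ := mem_iUnion.1 (hGN hy)
        exact mem_iUnion.2 ⟨Sum.inl i, hi⟩
      · obtain ⟨i, hi⟩ := mem_iUnion.1 (hc ▸ mem_univ y)
        exact mem_iUnion.2 ⟨Sum.inr i, hi, hy⟩)
  refine ⟨ι ⊕ ι, Sum.elim (fun i => (R (Sum.inl i) \ S) ∪ (V' i ∩ G))
    (fun i => R (Sum.inr i) \ S), ?_, ?_, ?_, ?_⟩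
  · rintro (i | i)
    exacts [((hRo _).sdiff hS).union ((hV'o i).inter hGo), (hRo _).sdiff hS]
  · refine eq_univ_of_forall fun y => ?_
    by_cases hy : y ∈ S
    · obtain ⟨i, hi⟩ := mem_iUnion.1 (hSV' hy)
      exact mem_iUnion.2 ⟨Sum.inl i, Or.inr ⟨hi, hSG hy⟩⟩
    · have hy' : y ∈ S' := (hun ▸ mem_univ y : y ∈ S ∪ S').resolve_left hy
      obtain ⟨i | i, hi⟩ := mem_iUnion.1 (hRc hy')
      · exact mem_iUnion.2 ⟨Sum.inl i, Or.inl ⟨hi, hy⟩⟩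
      · exact mem_iUnion.2 ⟨Sum.inr i, hi, hy⟩
  · rintro (i | i)
    · refine ⟨i, union_subset ?_ ?_⟩
      · exact sdiff_subset.trans ((hRO (Sum.inl i)).trans (inter_subset_left.trans (hVO i)))
      · exact inter_subset_left.trans (inter_subset_left.trans (hVO i))
    · exact ⟨i, sdiff_subset.trans ((hRO (Sum.inr i)).trans sdiff_subset)⟩
  · rintro s ⟨y, hy⟩
    by_cases hyG : y ∈ closure G
    · have hl : ∀ j ∈ s, ∃ i, j = Sum.inl i ∧ y ∈ V' i := by
        rintro (i | i) hi
        · rcases hy _ hi with h | h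
          · exact ⟨i, rfl, hRO (Sum.inl i) h.1⟩
          · exact ⟨i, rfl, h.1⟩
        · exact absurd hyG (hRO (Sum.inr i) (hy _ hi).1).2
      have hs : s = s.toLeft.map Function.Embedding.inl := by
        ext j
        constructor
        · intro hj
          obtain ⟨i, rfl, -⟩ := hl j hj
          simpa using hj
        · intro hj
          obtain ⟨i, hi, rfl⟩ := Finset.mem_map.1 hj
          simpa using hi
      rw [hs, Finset.card_map]
      refine hcard' _ ⟨y, fun i hi => ?_⟩
      obtain ⟨i', hi', hy'⟩ := hl (Sum.inl i) (by simpa using hi)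
      rwa [Sum.inl.inj hi']
    · have hyS : y ∉ S := fun h => hyG (subset_closure (hSG h))
      have hy' : y ∈ S' := (hun ▸ mem_univ y : y ∈ S ∪ S').resolve_left hyS
      refine hcardR s ⟨y, hy', ?_⟩
      rintro (i | i) hi
      · rcases hy _ hi with h | h
        · exact h.1
        · exact absurd (subset_closure h.2) hyG
      · exact (hy _ hi).1

theorem two_pi_mul_le_of_sin_nonneg {t : ℝ} {k : ℤ} (h0 : 0 ≤ Real.sin t)
    (hl : 2 * Real.pi * k - Real.pi < t) : 2 * Real.pi * k ≤ t := by
  by_contra! hlt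
  have := Real.sin_neg_of_neg_of_neg_pi_lt (x := t - k * (2 * Real.pi)) (by linarith) (by linarith)
  rw [Real.sin_sub_int_mul_two_pi] at this
  linarith

theorem le_two_pi_mul_add_of_sin_nonneg {t : ℝ} {k : ℤ} (h0 : 0 ≤ Real.sin t)
    (hu : t < 2 * Real.pi * k + 2 * Real.pi) : t ≤ 2 * Real.pi * k + Real.pi := by
  by_contra! hlt
  have h := Real.sin_neg_of_neg_of_neg_pi_lt (x := t - (k + 1 : ℤ) * (2 * Real.pi))
    (by push_cast; linarith) (by push_cast; linarith)
  rw [Real.sin_sub_int_mul_two_pi] at h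
  linarith

section OpenSubset

variable {E : Type} [MetricSpace E] {n : ℕ} {h : E → ℝ}

theorem subDimLE_shell (hE : CovDimLE E n) (hh : Continuous h) (a b : ℝ) :
    SubDimLE {z : {z // 0 < h z} | a ≤ (h z)⁻¹ ∧ (h z)⁻¹ ≤ b} n := by
  set Q : Set E := {z | 0 ≤ h z ∧ 1 ≤ b * h z ∧ a * h z ≤ 1} with hQ
  have hQc : IsClosed Q := (isClosed_le continuous_const hh).inter
    ((isClosed_le continuous_const (hh.const_mul b)).inter
      (isClosed_le (hh.const_mul a) continuous_const))
  have hpos : ∀ z ∈ Q, 0 < h z := fun z hz => hz.1.lt_of_ne fun h0 => by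
    have := hz.2.1
    rw [← h0] at this
    norm_num at this
  have hQdim : CovDimLE Q n := by
    refine SubDimLE.covDimLE (e := Subtype.val) Topology.IsInducing.subtypeVal ?_
    rw [Subtype.range_coe]
    exact hE.subDimLE_of_isClosed hQc
  have hind : Topology.IsInducing (fun z : Q => (⟨z, hpos z z.2⟩ : {z // 0 < h z})) :=
    .of_comp (by fun_prop) continuous_subtype_val Topology.IsInducing.subtypeVal
  convert subDimLE_range hind hQdim using 1
  ext ⟨z, hz⟩
  have key : (a ≤ (h z)⁻¹ ∧ (h z)⁻¹ ≤ b) ↔ z ∈ Q := by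
    rw [hQ, mem_ofPred_eq, ← one_div, le_div_iff₀ hz, div_le_iff₀ hz]
    exact ⟨fun h => ⟨hz.le, h.2, h.1⟩, fun h => ⟨h.2.2, h.2.1⟩⟩
  constructor
  · intro hza
    exact ⟨⟨z, key.1 hza⟩, rfl⟩
  · rintro ⟨⟨w, hw⟩, hwz⟩
    obtain rfl : w = z := congrArg Subtype.val hwz
    exact key.2 hw

theorem subDimLE_setOf_sin_nonneg (hE : CovDimLE E n) (hh : Continuous h) (c : ℝ) :
    SubDimLE {z : {z // 0 < h z} | 0 ≤ Real.sin ((h z)⁻¹ + c)} n := by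
  have hπ := Real.pi_pos
  have hcont : Continuous fun z : {z // 0 < h z} => (h z)⁻¹ + c :=
    ((hh.comp continuous_subtype_val).inv₀ fun z => z.2.ne').add continuous_const
  have htag : ∀ (t : ℝ) (k : ℤ), ⌊t / (2 * Real.pi)⌋ = k ↔
      2 * Real.pi * k ≤ t ∧ t < 2 * Real.pi * k + 2 * Real.pi := fun t k => by
    rw [Int.floor_eq_iff, le_div_iff₀ (by positivity), div_lt_iff₀ (by positivity)]
    constructor <;> rintro ⟨h1, h2⟩ <;> constructor <;> linarith
  refine subDimLE_of_fibers (fun z => ⌊((h z)⁻¹ + c) / (2 * Real.pi)⌋)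
    (fun k : ℤ => {z | 2 * Real.pi * k - Real.pi < (h z)⁻¹ + c} ∩
      {z | (h z)⁻¹ + c < 2 * Real.pi * k + 2 * Real.pi})
    (fun k => (isOpen_lt continuous_const hcont).inter (isOpen_lt hcont continuous_const))
    (fun k z hz => ?_) fun k => ?_
  · rw [htag]
    exact ⟨fun hk => ⟨two_pi_mul_le_of_sin_nonneg hz hk.1, hk.2⟩,
      fun hk => ⟨by have := hk.1; simp only [mem_ofPred_eq]; linarith, hk.2⟩⟩
  · convert subDimLE_shell hE hh (2 * Real.pi * k - c) (2 * Real.pi * k + Real.pi - c) using 1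
    ext z
    simp only [mem_ofPred_eq, htag]
    constructor
    · rintro ⟨h0, h1, h2⟩
      have := le_two_pi_mul_add_of_sin_nonneg h0 h2
      constructor <;> linarith
    · rintro ⟨h1, h2⟩
      refine ⟨?_, by linarith, by linarith⟩
      rw [← Real.sin_sub_int_mul_two_pi _ k]
      exact Real.sin_nonneg_of_nonneg_of_le_pi (by linarith) (by linarith)

/-- The open subset on which a continuous function is positive has dimension at most that of
the whole space. -/
theorem CovDimLE.subtype_pos (hE : CovDimLE E n) (hh : Continuous h) :
    CovDimLE {z // 0 < h z} n := by
  have hcont : Continuous fun z : {z // 0 < h z} => Real.sin ((h z)⁻¹ + 0) :=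
    Real.continuous_sin.comp
      (((hh.comp continuous_subtype_val).inv₀ fun z => z.2.ne').add continuous_const)
  refine covDimLE_of_union (isClosed_le continuous_const hcont) ?_
    (subDimLE_setOf_sin_nonneg hE hh 0) (subDimLE_setOf_sin_nonneg hE hh Real.pi)
  refine eq_univ_of_forall fun z => ?_
  rcases le_total 0 (Real.sin ((h z)⁻¹ + 0)) with h0 | h0
  · exact Or.inl h0
  · right
    rw [mem_ofPred_eq, Real.sin_add_pi]
    simpa using h0

end OpenSubset

/-- The fan over a subset `S` of a metric space `E`: a copy of `S`, at height zero, together with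
the disjoint graphs `{(z, h z) | 0 < h z}` of all `1`-Lipschitz functions `h` on `E`. -/
structure Fan {E : Type} [MetricSpace E] (S : Set E) where
  /-- `none` on the copy of `S`, and `some h` on the graph of `h`. -/
  tag : Option {h : E → ℝ // LipschitzWith 1 h}
  /-- The underlying point of `E`. -/
  pos : E
  mem : tag.elim (pos ∈ S) fun h => 0 < h.1 pos

namespace Fan

variable {E : Type} [MetricSpace E] {S : Set E}

/-- The height of a point of the fan. -/
def height (p : Fan S) : ℝ := p.tag.elim 0 fun h => h.1 p.pos

theorem height_nonneg (p : Fan S) : 0 ≤ p.height := by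
  rcases p with ⟨_ | h, z, hz⟩
  exacts [le_rfl, (show 0 < h.1 z from hz).le]

theorem height_pos {p : Fan S} (hp : p.tag ≠ none) : 0 < p.height := by
  rcases p with ⟨_ | h, z, hz⟩
  exacts [absurd rfl hp, hz]

theorem height_le_of_tag_eq {p q : Fan S} (hpq : p.tag = q.tag) :
    p.height ≤ q.height + dist p.pos q.pos := by
  rcases p with ⟨t, z, hz⟩
  rcases q with ⟨t', w, hw⟩
  obtain rfl : t = t' := hpq
  rcases t with _ | h
  · simp [height]
  · have := h.2.dist_le_mul z w
    rw [Real.dist_eq, NNReal.coe_one, one_mul] at this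
    have := le_abs_self (h.1 z - h.1 w)
    simp only [height, Option.elim]
    linarith

open Classical in
noncomputable instance : MetricSpace (Fan S) where
  dist p q := if p.tag = q.tag then dist p.pos q.pos
    else max (dist p.pos q.pos) (max p.height q.height)
  dist_self p := by simp
  dist_comm p q := by
    by_cases h : p.tag = q.tag
    · rw [if_pos h, if_pos h.symm, dist_comm]
    · rw [if_neg h, if_neg (Ne.symm h), dist_comm, max_comm p.height]
  dist_triangle p q r := by
    have h1 := dist_triangle p.pos q.pos r.pos
    have hd : 0 ≤ dist p.pos q.pos := dist_nonneg
    have hd' : 0 ≤ dist q.pos r.pos := dist_nonneg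
    have hp := p.height_nonneg
    have hq := q.height_nonneg
    have hr := r.height_nonneg
    by_cases hpq : p.tag = q.tag <;> by_cases hqr : q.tag = r.tag
    · rw [if_pos hpq, if_pos hqr, if_pos (hpq.trans hqr)]
      linarith
    · rw [if_pos hpq, if_neg hqr, if_neg (hpq ▸ hqr)]
      have := height_le_of_tag_eq hpq
      grind
    · rw [if_neg hpq, if_pos hqr, if_neg (hqr ▸ hpq)]
      have := height_le_of_tag_eq hqr.symm
      rw [dist_comm] at this
      grind
    · rw [if_neg hpq, if_neg hqr]
      split_ifs <;> grind
  eq_of_dist_eq_zero := by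
    intro p q hpq
    by_cases h : p.tag = q.tag
    · rw [if_pos h, dist_eq_zero] at hpq
      rcases p with ⟨t, z, hz⟩
      rcases q with ⟨t', w, hw⟩
      obtain rfl : t = t' := h
      obtain rfl : z = w := hpq
      rfl
    · rw [if_neg h] at hpq
      have h1 : p.height ≤ 0 := hpq ▸ (le_max_left _ _).trans (le_max_right _ _)
      have h2 : q.height ≤ 0 := hpq ▸ (le_max_right _ _).trans (le_max_right _ _)
      by_cases hpn : p.tag = none
      · exact absurd (height_pos (p := q) fun hqn => h (hpn.trans hqn.symm)) h2.not_gt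
      · exact absurd (height_pos hpn) h1.not_gt

open Classical in
theorem dist_of_tag_eq {p q : Fan S} (h : p.tag = q.tag) : dist p q = dist p.pos q.pos := by
  change ite _ _ _ = _
  rw [if_pos h]

open Classical in
theorem dist_of_tag_ne {p q : Fan S} (h : p.tag ≠ q.tag) :
    dist p q = max (dist p.pos q.pos) (max p.height q.height) := by
  change ite _ _ _ = _
  rw [if_neg h]

theorem dist_pos_le (p q : Fan S) : dist p.pos q.pos ≤ dist p q := by
  by_cases h : p.tag = q.tag
  · rw [dist_of_tag_eq h]
  · rw [dist_of_tag_ne h]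
    exact le_max_left _ _

theorem continuous_pos : Continuous (pos : Fan S → E) :=
  (LipschitzWith.of_dist_le_mul (K := 1) fun p q => by simpa using dist_pos_le p q).continuous

theorem isOpen_setOf_tag_eq {t : Option {h : E → ℝ // LipschitzWith 1 h}} (ht : t ≠ none) :
    IsOpen {p : Fan S | p.tag = t} := by
  rw [Metric.isOpen_iff]
  intro p hp
  have hp' : p.tag = t := hp
  refine ⟨p.height, height_pos (hp' ▸ ht), fun q hq => ?_⟩
  rw [mem_ofPred_eq, ← hp']
  by_contra hne
  rw [Metric.mem_ball, dist_of_tag_ne hne] at hq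
  exact absurd ((le_max_right _ _).trans (le_max_right _ _)) hq.not_ge

theorem isClosed_setOf_tag_eq_none : IsClosed {p : Fan S | p.tag = none} := by
  have : {p : Fan S | p.tag = none} = (⋃ t : {t // t ≠ none}, {p : Fan S | p.tag = t.1})ᶜ := by
    ext p
    simp only [mem_ofPred_eq, mem_compl_iff, mem_iUnion, not_exists]
    exact ⟨fun h t ht => t.2 (ht ▸ h), fun h => by_contra fun hp => h ⟨p.tag, hp⟩ rfl⟩
  rw [this]
  exact (isOpen_iUnion fun t => isOpen_setOf_tag_eq t.2).isClosed_compl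

/-- The copy of `S` in the fan. -/
def base (z : S) : Fan S := ⟨none, z, z.2⟩

theorem isometry_base : Isometry (base : S → Fan S) :=
  Isometry.of_dist_eq fun _ _ => dist_of_tag_eq rfl

theorem range_base : range (base : S → Fan S) = {p | p.tag = none} := by
  ext ⟨t, z, hz⟩
  constructor
  · rintro ⟨w, hw⟩
    exact (congrArg tag hw).symm
  · intro h
    obtain rfl : t = none := h
    exact ⟨⟨z, hz⟩, rfl⟩

/-- The graph of `h` in the fan. -/
def blade (h : {h : E → ℝ // LipschitzWith 1 h}) (z : {z // 0 < h.1 z}) : Fan S := ⟨some h, z, z.2⟩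

theorem isometry_blade (h : {h : E → ℝ // LipschitzWith 1 h}) :
    Isometry (blade h : _ → Fan S) :=
  Isometry.of_dist_eq fun _ _ => dist_of_tag_eq rfl

theorem range_blade (h : {h : E → ℝ // LipschitzWith 1 h}) :
    range (blade h : _ → Fan S) = {p | p.tag = some h} := by
  ext ⟨t, z, hz⟩
  constructor
  · rintro ⟨w, hw⟩
    exact (congrArg tag hw).symm
  · intro h
    obtain rfl := show t = _ from h
    exact ⟨⟨z, hz⟩, rfl⟩

theorem dist_blade_base (h : {h : E → ℝ // LipschitzWith 1 h}) (z : {z // 0 < h.1 z}) (x : S) :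
    dist (blade h z : Fan S) (base x) = max (dist (z : E) x) (h.1 z) := by
  rw [dist_of_tag_ne (by simp [blade, base])]
  simp [blade, base, height, z.2.le]

theorem covDimLE {n : ℕ} (hE : CovDimLE E n) (hS : CovDimLE S n) : CovDimLE (Fan S) n := by
  refine covDimLE_of_union (S' := {p | p.tag ≠ none}) isClosed_setOf_tag_eq_none
    (eq_univ_of_forall fun p => em _) ?_ ?_
  · rw [← range_base]
    exact subDimLE_range isometry_base.isUniformInducing.isInducing hS
  · refine subDimLE_of_fibers tag (fun t => {p | p.tag = t ∧ t ≠ none}) (fun t => ?_)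
      (fun t p hp => ?_) fun t => ?_
    · by_cases ht : t = none
      · simp [ht]
      · simpa [ht] using isOpen_setOf_tag_eq ht
    · exact ⟨And.left, fun h => ⟨h, h ▸ hp⟩⟩
    · rcases t with _ | h
      · intro ι U hU hc
        refine ⟨U, hU, fun _ => Subset.rfl, hc, ?_⟩
        rintro s ⟨p, ⟨hp, hp'⟩, -⟩
        exact absurd hp' hp
      · have : {p : Fan S | p ∈ {p | p.tag ≠ none} ∧ p.tag = some h} = range (blade h) := by
          rw [range_blade]
          ext p
          simp only [mem_ofPred_eq]
          exact ⟨And.right, fun hp => ⟨by simp [hp], hp⟩⟩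
        rw [this]
        exact subDimLE_range (isometry_blade h).isUniformInducing.isInducing
          (hE.subtype_pos h.2.continuous)

end Fan

/-- A space that is an `ANE(n)` of dimension at most `n` is approximately dominated by open subsets
of any metric space of dimension at most `n` in which it embeds. -/
theorem exists_factor_through_subtype_pos {n : ℕ} {X E κ : Type} [MetricSpace X] [MetricSpace E]
    (hX : CovDimLE X n) (hA : IsANE n X) (hE : CovDimLE E n) {i : X → E}
    (hi : Topology.IsEmbedding i) {U : κ → Set X} (hU : ∀ k, IsOpen (U k))
    (hc : ⋃ k, U k = univ) :
    ∃ h : E → ℝ, Continuous h ∧ ∃ (a : C(X, {z // 0 < h z})) (b : C({z // 0 < h z}, X)),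
      UClose U id (b ∘ a) := by
  rcases isEmpty_or_nonempty X with hXe | hXne
  · exact ⟨fun _ => 0, continuous_const, ⟨isEmptyElim, by fun_prop⟩,
      ⟨fun z => absurd z.2 (lt_irrefl 0), continuous_of_const fun z => absurd z.2 (lt_irrefl 0)⟩,
      isEmptyElim⟩
  have hS : CovDimLE (range i) n := by
    refine SubDimLE.covDimLE (e := Subtype.val) Topology.IsInducing.subtypeVal ?_
    rw [Subtype.range_coe]
    exact subDimLE_range hi.isInducing hX
  have hbase : Topology.IsEmbedding (Fan.base : range i → Fan (range i)) :=
    Fan.isometry_base.isEmbedding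
  set e := hi.toHomeomorph.trans hbase.toHomeomorph with he
  have hclosed : IsClosed (range (Fan.base : range i → Fan (range i))) := by
    rw [Fan.range_base]
    exact Fan.isClosed_setOf_tag_eq_none
  obtain ⟨V, hVo, hAV, g, hg⟩ := hA _ (Fan.covDimLE hE hS) _ hclosed ⟨e.symm, e.symm.continuous⟩
  choose U' hU'o hU' using fun k => hi.isInducing.isOpen_iff.1 (hU k)
  set O : Set (Fan (range i)) :=
    Subtype.val '' (⋃ k, g ⁻¹' U k ∩ (fun p : V => p.1.pos) ⁻¹' U' k) with hO
  have hOo : IsOpen O := hVo.isOpenMap_subtype_val _ (isOpen_iUnion fun k =>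
    ((hU k).preimage g.continuous).inter
      ((hU'o k).preimage (Fan.continuous_pos.comp continuous_subtype_val)))
  set pt : X → Fan (range i) := fun x => Fan.base ⟨i x, mem_range_self x⟩ with hpt
  have hptO : ∀ x, pt x ∈ O := by
    intro x
    obtain ⟨k, hk⟩ := mem_iUnion.1 (hc ▸ mem_univ x)
    have hgx : g (Set.inclusion hAV (e x)) = x := (hg (e x)).trans (e.symm_apply_apply x)
    refine ⟨Set.inclusion hAV (e x), mem_iUnion.2 ⟨k, ?_, ?_⟩, rfl⟩
    · rwa [mem_preimage, hgx]
    · rw [← hU' k] at hk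
      exact hk
  choose r hr1 hr0 hrO using fun x => show ∃ r : ℝ, r ≤ 1 ∧ 0 < r ∧ Metric.ball (pt x) r ⊆ O by
    obtain ⟨ε, hε, h⟩ := Metric.isOpen_iff.1 hOo _ (hptO x)
    exact ⟨min ε 1, min_le_right _ _, lt_min hε one_pos,
      (Metric.ball_subset_ball (min_le_left _ _)).trans h⟩
  have hbdd : ∀ z, BddAbove (range fun x => (r x - dist z (i x)) / 2) := fun z => by
    refine ⟨1, ?_⟩
    rintro _ ⟨x, rfl⟩
    have := hr1 x
    have : 0 ≤ dist z (i x) := dist_nonneg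
    change (r x - dist z (i x)) / 2 ≤ 1
    linarith
  set h : E → ℝ := fun z => ⨆ x, (r x - dist z (i x)) / 2 with hh
  have hlip : LipschitzWith 1 h := LipschitzWith.of_le_add fun z w => ciSup_le fun x => by
    have h1 := le_ciSup (hbdd w) x
    have h2 := dist_triangle w z (i x)
    have h3 : 0 ≤ dist z w := dist_nonneg
    rw [dist_comm w z] at h2
    change _ ≤ h w at h1
    linarith
  have hhi : ∀ x, 0 < h (i x) := fun x => by
    have h1 := le_ciSup (hbdd (i x)) x
    have h2 := hr0 x
    rw [dist_self] at h1
    change _ ≤ h (i x) at h1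
    linarith
  have hmem : ∀ z : {z // 0 < h z}, (Fan.blade ⟨h, hlip⟩ z : Fan (range i)) ∈ O := by
    rintro ⟨z, hz⟩
    obtain ⟨x, hx⟩ := exists_lt_of_lt_ciSup (show h z / 2 < h z by linarith)
    refine hrO x ?_
    rw [Metric.mem_ball, Fan.dist_blade_base]
    have : 0 ≤ dist z (i x) := dist_nonneg
    exact max_lt (show dist z (i x) < r x by linarith) (show h z < r x by linarith)
  have hOV : O ⊆ V := by
    rintro _ ⟨p, -, rfl⟩
    exact p.2
  refine ⟨h, hlip.continuous, ⟨fun x => ⟨i x, hhi x⟩, hi.continuous.subtype_mk _⟩,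
    ⟨fun z => g ⟨Fan.blade ⟨h, hlip⟩ z, hOV (hmem z)⟩,
      g.continuous.comp ((Fan.isometry_blade ⟨h, hlip⟩).continuous.subtype_mk _)⟩, fun x => ?_⟩
  obtain ⟨p, hp, hpx⟩ := hmem ⟨i x, hhi x⟩
  obtain ⟨k, hk, hk'⟩ := mem_iUnion.1 hp
  have hp' : p = ⟨Fan.blade ⟨h, hlip⟩ ⟨i x, hhi x⟩, hOV (hmem _)⟩ := Subtype.ext hpx
  refine ⟨k, ?_, ?_⟩
  · rw [← hU' k]
    rw [hp'] at hk'
    exact hk'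
  · rw [hp'] at hk
    exact hk

/-- A countable set can be enlarged to a countable set closed under countably many operations
sending finite sets to finite sets. -/
theorem exists_countable_superset_closed {α : Type} (P : Finset α → ℕ → Finset α) {S₀ : Set α}
    (h₀ : S₀.Countable) :
    ∃ S : Set α, S₀ ⊆ S ∧ S.Countable ∧ ∀ s : Finset α, (s : Set α) ⊆ S → ∀ m, (P s m : Set α) ⊆ S := by
  set step : Set α → Set α := fun T => T ∪ ⋃ s ∈ {s : Finset α | (s : Set α) ⊆ T}, ⋃ m, (P s m : Set α)
    with hstep
  set S : ℕ → Set α := fun k => step^[k] S₀ with hS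
  have hsucc : ∀ k, S (k + 1) = step (S k) := fun k => Function.iterate_succ_apply' step k S₀
  have hmono : Monotone S := monotone_nat_of_le_succ fun k => by
    rw [hsucc]
    exact subset_union_left
  have hcount : ∀ k, (S k).Countable := by
    intro k
    induction k with
    | zero => exact h₀
    | succ k ih =>
      rw [hsucc]
      refine ih.union (Countable.biUnion ?_ fun s _ => countable_iUnion fun m =>
        (P s m).finite_toSet.countable)
      have : {s : Finset α | (s : Set α) ⊆ S k} =
          (fun s : Finset α => (s : Set α)) ⁻¹' {t | t.Finite ∧ t ⊆ S k} := by
        ext s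
        simp
      rw [this]
      exact (countable_ofPred_finite_subset ih).preimage Finset.coe_injective
  refine ⟨⋃ k, S k, subset_iUnion S 0, countable_iUnion hcount, fun s hs m => ?_⟩
  obtain ⟨k, hk⟩ := hmono.directed_le.exists_mem_subset_of_finset_subset_biUnion hs
  refine subset_trans ?_ (subset_iUnion S (k + 1))
  rw [hsucc]
  exact (subset_iUnion (fun m => (P s m : Set α)) m).trans
    ((subset_biUnion_of_mem (u := fun s : Finset α => ⋃ m, (P s m : Set α)) hk).trans
      subset_union_right)

/-- In a normal space of dimension at most `n`, finitely many maps into the unit interval are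
nearly constant on the cozero sets of some finite family of order at most `n`. -/
theorem exists_finset_nearly_constant {X : Type} [TopologicalSpace X] [NormalSpace X] {n : ℕ}
    (hX : CovDimLE X n) (s : Finset C(X, unitInterval)) {ε : ℝ} (hε : 0 < ε) :
    ∃ P : Finset C(X, unitInterval), (∀ x, ∃ f ∈ P, f x = 1) ∧
      (∀ t ⊆ P, (∃ x, ∀ f ∈ t, 0 < f x) → t.card ≤ n + 1) ∧
      ∀ f ∈ P, ∀ x x', 0 < f x → 0 < f x' → ∀ g ∈ s, dist (g x) (g x') < ε := by
  classical
  obtain ⟨T, -, hTf, hT⟩ := finite_cover_balls_of_compact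
    (isCompact_univ : IsCompact (univ : Set (s → unitInterval))) (half_pos hε)
  have : Fintype T := hTf.fintype
  set φ : X → s → unitInterval := fun x g => g.1 x with hφ
  have hφc : Continuous φ := continuous_pi fun g => g.1.continuous
  obtain ⟨V, hVo, hVU, hVc, hcard⟩ := hX.exists_shrink (fun p : T => φ ⁻¹' Metric.ball p.1 (ε / 2))
    (fun p => Metric.isOpen_ball.preimage hφc) (by
      refine eq_univ_of_forall fun x => ?_
      obtain ⟨p, hp, hx⟩ := mem_iUnion₂.1 (hT (mem_univ (φ x)))
      exact mem_iUnion.2 ⟨⟨p, hp⟩, hx⟩)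
  obtain ⟨F, hF⟩ := BumpCovering.exists_isSubordinate_of_locallyFinite isClosed_univ V hVo
    (locallyFinite_of_finite V) hVc.ge
  set G : T → C(X, unitInterval) := fun p =>
    ⟨fun x => ⟨F p x, F.nonneg p x, F.le_one p x⟩, (F p).continuous.subtype_mk _⟩ with hG
  have hGV : ∀ p x, 0 < G p x → x ∈ V p := fun p x hx =>
    hF p (subset_closure (Function.mem_support.2 (ne_of_gt (show 0 < F p x from hx))))
  refine ⟨Finset.univ.image G, fun x => ?_, fun t ht ⟨x, hx⟩ => ?_, ?_⟩
  · obtain ⟨p, hp⟩ := F.eventuallyEq_one' x (mem_univ x)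
    exact ⟨G p, Finset.mem_image_of_mem G (Finset.mem_univ p), Subtype.ext hp.eq_of_nhds⟩
  · have hsub : t ⊆ (Finset.univ.filter fun p => G p ∈ t).image G := fun f hf => by
      obtain ⟨p, -, rfl⟩ := Finset.mem_image.1 (ht hf)
      exact Finset.mem_image_of_mem G (by simpa using hf)
    refine ((Finset.card_le_card hsub).trans Finset.card_image_le).trans (hcard _ ⟨x, ?_⟩)
    intro p hp
    exact hGV p x (hx _ (Finset.mem_filter.1 hp).2)
  · intro f hf x x' hx hx' g hg
    obtain ⟨p, -, rfl⟩ := Finset.mem_image.1 hf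
    have h1 : dist (φ x) p.1 < ε / 2 := hVU p (hGV p x hx)
    have h2 : dist (φ x') p.1 < ε / 2 := hVU p (hGV p x' hx')
    have h3 : dist (g x) (g x') ≤ dist (φ x) (φ x') := dist_le_pi_dist (φ x) (φ x') ⟨g, hg⟩
    have h4 := dist_triangle_right (φ x) (φ x') p.1
    linarith

/-- Entourages of a subspace of a cube contain the relation of being close at finitely many
coordinates. -/
theorem exists_finset_of_mem_uniformity {J : Type} {E : Set (J → unitInterval)} {V : Set (E × E)}
    (hV : V ∈ uniformity E) :
    ∃ (s : Finset J) (ε : ℝ), 0 < ε ∧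
      ∀ z w : E, (∀ j ∈ s, dist (z.1 j) (w.1 j) < ε) → (z, w) ∈ V := by
  rw [uniformity_subtype, Filter.mem_comap] at hV
  obtain ⟨V₁, hV₁, hVV⟩ := hV
  rw [Pi.uniformity, Filter.mem_iInf'] at hV₁
  obtain ⟨I, hI, W, hW, -, rfl, -⟩ := hV₁
  have hW' : ∀ j, ∃ ε > 0, ∀ z w : J → unitInterval, dist (z j) (w j) < ε → (z, w) ∈ W j := by
    intro j
    obtain ⟨W', hW', hsub⟩ := Filter.mem_comap.1 (hW j)
    obtain ⟨ε, hε, h⟩ := Metric.mem_uniformity_dist.1 hW'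
    exact ⟨ε, hε, fun z w hzw => hsub (h hzw)⟩
  choose ε hε h using hW'
  have hev : ∀ᶠ e in nhdsWithin (0 : ℝ) (Ioi 0), ∀ j ∈ I, e < ε j :=
    (Filter.eventually_all_finite hI).2 fun j _ => nhdsWithin_le_nhds (Iio_mem_nhds (hε j))
  obtain ⟨e, he, he0⟩ := (hev.and self_mem_nhdsWithin).exists
  refine ⟨hI.toFinset, e, he0, fun z w hzw => hVV (mem_iInter₂.2 fun j hj => ?_)⟩
  exact h j z.1 w.1 ((hzw j (hI.mem_toFinset.2 hj)).trans (he j hj))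

/-- A separable metric space of dimension at most `n` has a metrizable compactification of
dimension at most `n`. -/
theorem exists_compactification {X : Type} [MetricSpace X] [SecondCountableTopology X] {n : ℕ}
    (hX : CovDimLE X n) :
    ∃ (E : Type) (_ : MetricSpace E), CompactSpace E ∧ CovDimLE E n ∧
      ∃ i : X → E, Topology.IsEmbedding i := by
  classical
  rcases isEmpty_or_nonempty X with hXe | hXne
  · exact ⟨X, inferInstance, inferInstance, hX, id, Topology.IsEmbedding.id⟩
  obtain ⟨H, hH⟩ := Metric.PiNatEmbed.exists_embedding_to_hilbert_cube (X := X)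
  choose P hP1 hPcard hPs using fun (s : Finset C(X, unitInterval)) (m : ℕ) =>
    exists_finset_nearly_constant hX s (ε := 1 / ((m : ℝ) + 1)) Nat.one_div_pos_of_nat
  obtain ⟨S, hS₀, hSc, hSP⟩ := exists_countable_superset_closed P
    (countable_range fun k : ℕ => (⟨fun x => H x k, (continuous_apply k).comp hH.continuous⟩ :
      C(X, unitInterval)))
  have : Countable S := hSc.to_subtype
  set ev : X → S → unitInterval := fun x f => f.1 x with hev
  have hevc : Continuous ev := continuous_pi fun f => f.1.continuous
  set E : Set (S → unitInterval) := closure (range ev) with hE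
  have hEc : CompactSpace E := isCompact_iff_compactSpace.1 isClosed_closure.isCompact
  have hevE : ∀ x, ev x ∈ E := fun x => subset_closure (mem_range_self x)
  refine ⟨E, TopologicalSpace.metrizableSpaceMetric E, hEc, ?_, fun x => ⟨ev x, hevE x⟩, ?_⟩
  · intro ι U hU hc
    obtain ⟨V, hV, hVU⟩ := lebesgue_number_lemma (isCompact_univ : IsCompact (univ : Set E)) hU hc.ge
    obtain ⟨s, ε, hε, hs⟩ := exists_finset_of_mem_uniformity hV
    obtain ⟨m, hm⟩ := exists_nat_one_div_lt (half_pos hε)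
    set s' : Finset C(X, unitInterval) := s.image Subtype.val with hs'
    have hs'S : (s' : Set C(X, unitInterval)) ⊆ S := by
      intro f hf
      obtain ⟨g, -, rfl⟩ := Finset.mem_image.1 (Finset.mem_coe.1 hf)
      exact g.2
    have hPS := hSP s' hs'S m
    set Q := P s' m with hQ
    refine ⟨Q, fun f => {z : E | 0 < z.1 ⟨f.1, hPS f.2⟩}, fun f => ?_, ?_, fun f => ?_, ?_⟩
    · exact isOpen_lt continuous_const ((continuous_apply _).comp continuous_subtype_val)
    · refine eq_univ_of_forall fun z => ?_
      have hcl : IsClosed (⋃ f : Q, {z : S → unitInterval | z ⟨f.1, hPS f.2⟩ = 1}) :=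
        isClosed_iUnion_of_finite fun f => isClosed_eq (continuous_apply _) continuous_const
      have hz := closure_minimal (s := range ev) (by
        rintro _ ⟨x, rfl⟩
        obtain ⟨f, hf, hfx⟩ := hP1 s' m x
        exact mem_iUnion.2 ⟨⟨f, hf⟩, hfx⟩) hcl z.2
      obtain ⟨f, hf⟩ := mem_iUnion.1 hz
      refine mem_iUnion.2 ⟨f, ?_⟩
      change 0 < z.1 _
      rw [show z.1 _ = 1 from hf]
      exact zero_lt_one
    · have key : ∀ z : E, 0 < z.1 ⟨f.1, hPS f.2⟩ →
          ∃ x, 0 < f.1 x ∧ ∀ g ∈ s, dist (z.1 g) (g.1 x) < ε / 4 := by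
        intro z hz
        have ho : IsOpen ({y : S → unitInterval | 0 < y ⟨f.1, hPS f.2⟩} ∩
            ⋂ g ∈ s, {y | dist (z.1 g) (y g) < ε / 4}) :=
          (isOpen_lt continuous_const (continuous_apply _)).inter
            (isOpen_biInter_finset fun g _ =>
              isOpen_lt (continuous_const.dist (continuous_apply g)) continuous_const)
        obtain ⟨_, ⟨hy1, hy2⟩, x, rfl⟩ := mem_closure_iff.1 z.2 _ ho ⟨hz, mem_iInter₂.2 fun g _ => by
          simp only [mem_ofPred_eq, dist_self]
          positivity⟩
        exact ⟨x, hy1, fun g hg => mem_iInter₂.1 hy2 g hg⟩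
      by_cases hne : ∃ z : E, 0 < z.1 ⟨f.1, hPS f.2⟩
      · obtain ⟨z, hz⟩ := hne
        obtain ⟨i, hi⟩ := hVU z (mem_univ z)
        refine ⟨i, fun w hw => hi (hs z w fun g hg => ?_)⟩
        obtain ⟨x, hx, hxz⟩ := key z hz
        obtain ⟨x', hx', hxw⟩ := key w hw
        have h1 := hPs s' m f.1 f.2 x x' hx hx' g.1 (Finset.mem_image_of_mem _ hg)
        have h2 := hxz g hg
        have h3 := hxw g hg
        have h4 := dist_triangle4_right (z.1 g) (w.1 g) (g.1 x) (g.1 x')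
        linarith
      · obtain ⟨i, -⟩ := hVU ⟨_, hevE (Classical.arbitrary X)⟩ (mem_univ _)
        exact ⟨i, fun w hw => absurd ⟨w, hw⟩ hne⟩
    · rintro t ⟨z, hz⟩
      have ho : IsOpen (⋂ f ∈ t, {y : S → unitInterval | 0 < y ⟨f.1, hPS f.2⟩}) :=
        isOpen_biInter_finset fun f _ => isOpen_lt continuous_const (continuous_apply _)
      obtain ⟨_, hy, x, rfl⟩ := mem_closure_iff.1 z.2 _ ho (mem_iInter₂.2 hz)
      rw [← Finset.card_image_of_injective t Subtype.val_injective]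
      refine hPcard s' m _ (fun f hf => ?_) ⟨x, fun f hf => ?_⟩
      · obtain ⟨g, -, rfl⟩ := Finset.mem_image.1 hf
        exact g.2
      · obtain ⟨g, hg, rfl⟩ := Finset.mem_image.1 hf
        exact mem_iInter₂.1 hy g hg
  · have hcont : Continuous fun z : E => fun k : ℕ => z.1 ⟨_, hS₀ (mem_range_self k)⟩ :=
      continuous_pi fun k => (continuous_apply _).comp continuous_subtype_val
    exact Topology.IsEmbedding.of_comp (hevc.subtype_mk _) hcont hH

/-- Every open cover of a metric space has a Lebesgue function. -/
theorem exists_lebesgue_function {X ι : Type} [MetricSpace X] {U : ι → Set X}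
    (hU : ∀ i, IsOpen (U i)) (hc : ⋃ i, U i = univ) :
    ∃ σ : X → ℝ, LipschitzWith 1 σ ∧ (∀ x, 0 < σ x) ∧ (∀ x, σ x ≤ 1) ∧
      ∀ x, ∃ i, Metric.ball x (σ x) ⊆ U i := by
  set S : X → Set ℝ := fun x => {r | 0 ≤ r ∧ r ≤ 1 ∧ ∃ i, Metric.ball x r ⊆ U i} with hS
  have hbdd : ∀ x, BddAbove (S x) := fun x => ⟨1, fun r hr => hr.2.1⟩
  have hpos : ∀ x, 0 < sSup (S x) := fun x => by
    obtain ⟨i, hi⟩ := mem_iUnion.1 (hc ▸ mem_univ x)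
    obtain ⟨ε, hε, h⟩ := Metric.isOpen_iff.1 (hU i) x hi
    exact (lt_min hε one_pos).trans_le (le_csSup (hbdd x) ⟨(lt_min hε one_pos).le,
      min_le_right _ _, i, (Metric.ball_subset_ball (min_le_left _ _)).trans h⟩)
  have hne : ∀ x, (S x).Nonempty := fun x => nonempty_iff_ne_empty.2 fun h => by
    have := hpos x
    rw [h, Real.sSup_empty] at this
    exact lt_irrefl 0 this
  refine ⟨fun x => sSup (S x) / 2, LipschitzWith.of_le_add fun x y => ?_,
    fun x => half_pos (hpos x), fun x => ?_, fun x => ?_⟩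
  · have hd : 0 ≤ dist x y := dist_nonneg
    have : sSup (S x) ≤ sSup (S y) + dist x y := csSup_le (hne x) fun r ⟨_, hr1, i, hi⟩ => by
      by_cases h : dist x y ≤ r
      · have : r - dist x y ∈ S y := ⟨sub_nonneg.2 h, by linarith, i,
          (Metric.ball_subset_ball' (by rw [dist_comm y x]; linarith)).trans hi⟩
        linarith [le_csSup (hbdd y) this]
      · linarith [hpos y]
    linarith
  · have : sSup (S x) ≤ 1 := csSup_le (hne x) fun r hr => hr.2.1
    linarith
  · obtain ⟨r, ⟨-, -, i, hi⟩, hr⟩ := exists_lt_of_lt_csSup (hne x) (half_lt_self (hpos x))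
    exact ⟨i, (Metric.ball_subset_ball hr.le).trans hi⟩

theorem iUnion_ball_lebesgue {X : Type} [MetricSpace X] {σ : X → ℝ} (hσ : ∀ x, 0 < σ x) :
    ⋃ x, Metric.ball x (σ x / 16) = univ :=
  eq_univ_of_forall fun x => mem_iUnion.2 ⟨x, Metric.mem_ball_self (by have := hσ x; positivity)⟩

theorem UClose.dist_le {Z X : Type} [MetricSpace X] {σ : X → ℝ} (hσ : LipschitzWith 1 σ)
    {f g : Z → X} (h : UClose (fun x => Metric.ball x (σ x / 16)) f g) (z : Z) :
    dist (f z) (g z) ≤ σ (f z) / 7 := by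
  obtain ⟨x, hf, hg⟩ := h z
  rw [Metric.mem_ball] at hf hg
  have h1 := hσ.dist_le_mul x (f z)
  have h2 := dist_triangle_right (f z) (g z) x
  rw [Real.dist_eq, NNReal.coe_one, one_mul, dist_comm x] at h1
  have h3 := (abs_le.1 h1).2
  have h4 : 0 ≤ dist (f z) x := dist_nonneg
  linarith

theorem isCompact_setOf_inv_le {E : Type} [TopologicalSpace E] [CompactSpace E] {h : E → ℝ}
    (hh : Continuous h) (r : ℝ) : IsCompact {z : {z // 0 < h z} | (h z)⁻¹ ≤ r} := by
  rw [Topology.IsEmbedding.subtypeVal.isCompact_iff]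
  have : Subtype.val '' {z : {z // 0 < h z} | (h z)⁻¹ ≤ r} = {z | 0 ≤ h z ∧ 1 ≤ r * h z} := by
    ext z
    constructor
    · rintro ⟨w, hw, rfl⟩
      exact ⟨w.2.le, (inv_le_iff_one_le_mul₀ w.2).1 hw⟩
    · rintro ⟨h0, h1⟩
      have hz : 0 < h z := h0.lt_of_ne fun h0 => by
        rw [← h0, mul_zero] at h1
        linarith
      exact ⟨⟨z, hz⟩, (inv_le_iff_one_le_mul₀ hz).2 h1, rfl⟩
  rw [this]
  exact ((isClosed_le continuous_const hh).inter
    (isClosed_le continuous_const (hh.const_mul r))).isCompact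

/-- A strong `Z`-set: the identity is approximable by maps whose ranges have closures missing the
set. -/
def IsStrongZSet {X : Type} [TopologicalSpace X] (B : Set X) : Prop :=
  IsClosed B ∧ ∀ (ι : Type) (U : ι → Set X), (∀ i, IsOpen (U i)) → (⋃ i, U i) = univ →
    ∃ f : C(X, X), UClose U id f ∧ Disjoint (closure (range f)) B

/-- In an `N_n`-space every `Z`-set is a strong `Z`-set. -/
theorem IsZSet.isStrongZSet {n : ℕ} {X : Type} [MetricSpace X] (hX : IsNnSpace n X) {B : Set X}
    (hB : IsZSet X B) : IsStrongZSet B := by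
  refine ⟨hB.1, fun ι U hU hc => ?_⟩
  obtain ⟨hPol, ⟨hdim, -⟩, hANE, hSU⟩ := hX
  obtain ⟨σ, hσL, hσ0, -, hσU⟩ := exists_lebesgue_function hU hc
  set V : X → Set X := fun x => Metric.ball x (σ x / 16) with hV
  have hVo : ∀ x, IsOpen (V x) := fun x => Metric.isOpen_ball
  have hVc : ⋃ x, V x = univ := iUnion_ball_lebesgue hσ0
  obtain ⟨E, _, hEc, hE, i, hi⟩ := exists_compactification hdim
  obtain ⟨h, hh, a, b, hab⟩ := exists_factor_through_subtype_pos hdim hANE hE hi hVo hVc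
  have hL : PolishSpace {z // 0 < h z} := (isOpen_lt continuous_const hh).polishSpace
  obtain ⟨b', hbb', hb'⟩ := hSU _ hL (hE.subtype_pos hh) b X V hVo hVc
  obtain ⟨w, hw⟩ := ContinuousMap.exists_extension hb' (⟨fun z : {z // 0 < h z} => (h z)⁻¹,
    (hh.comp continuous_subtype_val).inv₀ fun z => z.2.ne'⟩ : C({z // 0 < h z}, ℝ))
  have hw' : ∀ z, w (b' z) = (h z)⁻¹ := fun z => DFunLike.congr_fun hw z
  obtain ⟨f, hf, hfB⟩ := hB.2 (ℝ × X) (fun p => w ⁻¹' Metric.ball p.1 (1 / 2) ∩ V p.2)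
    (fun p => (Metric.isOpen_ball.preimage w.continuous).inter (hVo _)) (by
      refine eq_univ_of_forall fun x => ?_
      obtain ⟨y, hy⟩ := mem_iUnion.1 (hVc ▸ mem_univ x)
      exact mem_iUnion.2 ⟨(w x, y), Metric.mem_ball_self (by norm_num), hy⟩)
  have hfV : UClose V id f := fun x => (hf x).elim fun p hp => ⟨p.2, hp.1.2, hp.2.2⟩
  have hfw : ∀ x, |w x - w (f x)| < 1 := fun x => by
    obtain ⟨p, hp, hp'⟩ := hf x
    have h1 : dist (w x) p.1 < 1 / 2 := hp.1
    have h2 : dist (w (f x)) p.1 < 1 / 2 := hp'.1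
    have h3 := dist_triangle_right (w x) (w (f x)) p.1
    rw [← Real.dist_eq]
    linarith
  refine ⟨f.comp (b'.comp a), fun x => ?_, ?_⟩
  · have hlip : ∀ y z, σ z ≤ σ y + dist y z := fun y z => by
      have := hσL.dist_le_mul z y
      rw [Real.dist_eq, NNReal.coe_one, one_mul, dist_comm z y] at this
      linarith [(abs_le.1 this).2]
    have h1 : dist x (b (a x)) ≤ σ x / 7 := UClose.dist_le hσL hab x
    have h2 : dist (b (a x)) (b' (a x)) ≤ σ (b (a x)) / 7 := UClose.dist_le hσL hbb' (a x)
    have h3 : dist (b' (a x)) (f (b' (a x))) ≤ σ (b' (a x)) / 7 := UClose.dist_le hσL hfV (b' (a x))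
    have h4 := hlip x (b (a x))
    have h5 := hlip (b (a x)) (b' (a x))
    have h6 := dist_triangle4 x (b (a x)) (b' (a x)) (f (b' (a x)))
    have h7 := hσ0 x
    obtain ⟨i, hi⟩ := hσU x
    refine ⟨i, hi (Metric.mem_ball_self h7), hi ?_⟩
    rw [Metric.mem_ball, dist_comm]
    change dist x (f (b' (a x))) < σ x
    linarith
  · refine disjoint_left.2 fun y hy hyB => ?_
    set K := (fun z => f (b' z)) '' {z : {z // 0 < h z} | (h z)⁻¹ ≤ w y + 2} with hK
    have hKc : IsClosed K := ((isCompact_setOf_inv_le hh _).image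
      (f.continuous.comp b'.continuous)).isClosed
    have hyK : y ∈ K := by
      refine hKc.closure_subset_iff.2 ?_ (closure_mono subset_rfl
        ((isOpen_lt w.continuous continuous_const).inter_closure ⟨(lt_add_one (w y) : _), hy⟩))
      rintro _ ⟨hlt, x, rfl⟩
      refine ⟨a x, ?_, rfl⟩
      have h1 := (abs_lt.1 (hfw (b' (a x)))).2
      have h2 : w (f (b' (a x))) < w y + 1 := hlt
      rw [hw'] at h1
      change (h (a x))⁻¹ ≤ w y + 2
      linarith
    obtain ⟨z, -, rfl⟩ := hyK
    exact hfB _ hyB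

/-- A map displacing points by less than a given control whose values stay away from a strong
`Z`-set in a controlled way. -/
theorem IsStrongZSet.exists_controlled {X : Type} [MetricSpace X] {B : Set X} (hB : IsStrongZSet B)
    {σ : X → ℝ} (hσ : LipschitzWith 1 σ) (hσ0 : ∀ x, 0 < σ x) :
    ∃ (g : C(X, X)) (σ' : X → ℝ), LipschitzWith 1 σ' ∧ (∀ x, 0 < σ' x) ∧
      (∀ x, σ' x ≤ σ x / 2) ∧ (∀ x, dist x (g x) ≤ σ x / 4) ∧
      ∀ x, Disjoint (Metric.ball (g x) (σ' (g x))) B := by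
  obtain ⟨g, hg, hgB⟩ := hB.2 X _ (fun x => Metric.isOpen_ball) (iUnion_ball_lebesgue hσ0)
  obtain ⟨τ, hτL, hτ0, -, hτ⟩ := exists_lebesgue_function
    (U := fun o : Bool => bif o then Bᶜ else (closure (range g))ᶜ)
    (by rintro (_ | _); exacts [isClosed_closure.isOpen_compl, hB.1.isOpen_compl])
    (eq_univ_of_forall fun x => mem_iUnion.2 (by
      by_cases hx : x ∈ B
      · exact ⟨false, disjoint_right.1 hgB hx⟩
      · exact ⟨true, hx⟩))
  have hhalf : LipschitzWith 1 fun x => σ x / 2 := LipschitzWith.of_le_add fun x y => by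
    have := hσ.dist_le_mul x y
    rw [Real.dist_eq, NNReal.coe_one, one_mul] at this
    linarith [(abs_le.1 this).2, dist_nonneg (x := x) (y := y)]
  refine ⟨g, fun x => min (σ x / 2) (τ x), by simpa using hhalf.min hτL,
    fun x => lt_min (half_pos (hσ0 x)) (hτ0 x), fun x => min_le_left _ _, fun x => ?_, fun x => ?_⟩
  · have h1 : dist x (g x) ≤ σ x / 7 := UClose.dist_le hσ hg x
    linarith [hσ0 x]
  · obtain ⟨o, ho⟩ := hτ (g x)
    cases o with
    | false =>
      exact absurd (subset_closure (mem_range_self x)) (ho (Metric.mem_ball_self (hτ0 _)))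
    | true =>
      exact disjoint_left.2 fun y hy => ho (Metric.ball_subset_ball (min_le_right _ _) hy)

/-- In a completely metrizable space, the identity is approximable by maps missing a given sequence
of strong `Z`-sets. -/
theorem exists_uclose_id_forall_notMem {X ι : Type} [TopologicalSpace X]
    [TopologicalSpace.IsCompletelyMetrizableSpace X] {B : ℕ → Set X} (hB : ∀ k, IsStrongZSet (B k))
    {U : ι → Set X} (hU : ∀ i, IsOpen (U i)) (hc : ⋃ i, U i = univ) :
    ∃ f : C(X, X), UClose U id f ∧ ∀ x k, f x ∉ B k := by
  let := TopologicalSpace.upgradeIsCompletelyMetrizable X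
  obtain ⟨σ₀, hσ₀L, hσ₀0, hσ₀1, hσ₀U⟩ := exists_lebesgue_function hU hc
  choose G S hSL hS0 hS2 hG hGB using fun (k : ℕ)
      (σ : {σ : X → ℝ // LipschitzWith 1 σ ∧ ∀ x, 0 < σ x}) =>
    (hB k).exists_controlled σ.2.1 σ.2.2
  set σ : ℕ → {σ : X → ℝ // LipschitzWith 1 σ ∧ ∀ x, 0 < σ x} := fun k =>
    Nat.rec ⟨σ₀, hσ₀L, hσ₀0⟩ (fun k σ => ⟨S k σ, hSL k σ, hS0 k σ⟩) k with hσ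
  set F : ℕ → C(X, X) := fun k =>
    Nat.rec (ContinuousMap.id X) (fun k f => (G k (σ k)).comp f) k with hF
  have hpos : ∀ k x, 0 < (σ k).1 x := fun k => (σ k).2.2
  have hstep : ∀ k x, dist (F k x) (F (k + 1) x) ≤ (σ k).1 (F k x) / 4 := fun k x => hG k (σ k) _
  have hdecr : ∀ k x, (σ (k + 1)).1 (F (k + 1) x) ≤ 5 / 8 * (σ k).1 (F k x) := fun k x => by
    have h1 : (σ (k + 1)).1 (F (k + 1) x) ≤ (σ k).1 (F (k + 1) x) / 2 := hS2 k (σ k) _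
    have h2 := (σ k).2.1.dist_le_mul (F (k + 1) x) (F k x)
    rw [Real.dist_eq, NNReal.coe_one, one_mul, dist_comm (F (k + 1) x)] at h2
    linarith [(abs_le.1 h2).2, hstep k x]
  have hgeom : ∀ k x, (σ k).1 (F k x) ≤ (5 / 8) ^ k := fun k x => by
    induction k with
    | zero => exact (hσ₀1 x).trans_eq (pow_zero _).symm
    | succ k ih =>
      rw [pow_succ']
      linarith [hdecr k x]
  have horbit : ∀ k x m, dist (F k x) (F (k + m) x) ≤
      2 / 3 * (σ k).1 (F k x) - 2 / 3 * (σ (k + m)).1 (F (k + m) x) := fun k x m => by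
    induction m with
    | zero => simp
    | succ m ih =>
      have h1 := dist_triangle (F k x) (F (k + m) x) (F (k + m + 1) x)
      have h2 := hstep (k + m) x
      have h3 := hdecr (k + m) x
      rw [← add_assoc]
      linarith
  have hcauchy : ∀ x, CauchySeq fun k => F k x := fun x =>
    cauchySeq_of_le_geometric (5 / 8) (1 / 4) (by norm_num) fun k => by
      linarith [hstep k x, hgeom k x]
  choose f hf using fun x => cauchySeq_tendsto_of_complete (hcauchy x)
  have hdist : ∀ k x, dist (F k x) (f x) ≤ 2 / 3 * (σ k).1 (F k x) := fun k x => by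
    refine le_of_tendsto (tendsto_const_nhds.dist
      ((Filter.tendsto_add_atTop_iff_nat k).2 (hf x))) (Filter.Eventually.of_forall fun m => ?_)
    rw [add_comm]
    linarith [horbit k x m, hpos (k + m) (F (k + m) x)]
  have hunif : TendstoUniformly (fun k x => F k x) f Filter.atTop := by
    rw [Metric.tendstoUniformly_iff]
    intro ε hε
    filter_upwards [(tendsto_pow_atTop_nhds_zero_of_lt_one (r := (5 / 8 : ℝ)) (by norm_num)
      (by norm_num)).eventually_lt_const hε] with k hk x
    rw [dist_comm]
    linarith [hdist k x, hgeom k x, hpos k (F k x)]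
  refine ⟨⟨f, hunif.continuous (Filter.Frequently.of_forall fun k => (F k).continuous)⟩,
    fun x => ?_, fun x k hk => ?_⟩
  · obtain ⟨i, hi⟩ := hσ₀U x
    refine ⟨i, hi (Metric.mem_ball_self (hσ₀0 x)), hi ?_⟩
    have h1 : dist x (f x) ≤ 2 / 3 * σ₀ x := hdist 0 x
    rw [Metric.mem_ball, dist_comm]
    change dist x (f x) < σ₀ x
    linarith [hσ₀0 x]
  · refine disjoint_left.1 (hGB k (σ k) (F k x)) ?_ hk
    have h1 := hdist (k + 1) x
    have h2 := hpos (k + 1) (F (k + 1) x)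
    rw [Metric.mem_ball, dist_comm]
    change dist (F (k + 1) x) (f x) < (σ (k + 1)).1 (F (k + 1) x)
    linarith

/-- In an `N_n`-space, a closed subset that is a countable union of `Z`-sets is a
`Z`-set. -/
theorem isZSet_of_closed_countable_union (n : ℕ) (X : Type) [MetricSpace X]
    (hX : IsNnSpace n X) (A : Set X) (hA : IsClosed A)
    (B : ℕ → Set X) (hB : ∀ k, IsZSet X (B k)) (hAB : A = ⋃ k, B k) :
    IsZSet X A := by
  have : PolishSpace X := hX.1
  refine ⟨hA, fun ι U hU hc => ?_⟩
  obtain ⟨f, hfU, hfB⟩ := exists_uclose_id_forall_notMem (fun k => (hB k).isStrongZSet hX) hU hc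
  refine ⟨f, hfU, fun x hx => ?_⟩
  rw [hAB] at hx
  obtain ⟨k, hk⟩ := mem_iUnion.1 hx
  exact hfB x k hk

end NobelingPaper
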